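/- Fix the literal x = x_1 and, for each n ≥ 1, let 𝒳 be the family of simple x trees on n variables. Then the limiting ratio μ_n(𝒳) exists for every n and μ_n(𝒳) ∼ P_n(True)/n² as n → ∞, i.e. n²·μ_n(𝒳)/P_n(True) → 1. -/

import Mathlib

/-- An and/or tree skeleton: leaves carry a variable index and a polarity
(`true` = positive literal, `false` = negated literal); internal nodes carry
a connective (`true` = AND, `false` = OR) and a list of children. -/
inductive AT (n : ℕ) : Type
  | leaf : Fin n → Bool → AT n
  | node : Bool → List (AT n) → AT n

namespace AT

/-- The connective at the root, if the root is an internal node. -/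
def rootConn {n : ℕ} : AT n → Option Bool
  | .leaf _ _ => none
  | .node c _ => some c

/-- Whether a tree is a single leaf. -/
def isLeafB {n : ℕ} : AT n → Bool
  | .leaf _ _ => true
  | .node _ _ => false

/-- The children of the root. -/
def rootChildren {n : ℕ} : AT n → List (AT n)
  | .leaf _ _ => []
  | .node _ ts => ts

/-- Well-formedness: an associative tree is a plane tree in which each internal
node has at least two children, no internal node has the same connective as its
parent (stratification), and leaves carry literals. -/
inductive WF {n : ℕ} : AT n → Prop
  | leaf (i : Fin n) (b : Bool) : WF (.leaf i b)
  | node (c : Bool) (ts : List (AT n)) :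
      2 ≤ ts.length → (∀ t ∈ ts, WF t) → (∀ t ∈ ts, rootConn t ≠ some c) →
      WF (.node c ts)

mutual
/-- The size of a tree: its total number of nodes. -/
def size {n : ℕ} : AT n → ℕ
  | .leaf _ _ => 1
  | .node _ ts => 1 + sizeList ts
def sizeList {n : ℕ} : List (AT n) → ℕ
  | [] => 0
  | t :: ts => size t + sizeList ts
end

mutual
/-- The Boolean function computed by a tree. -/
def eval {n : ℕ} : AT n → (Fin n → Bool) → Bool
  | .leaf i b, x => if b then x i else ! x i
  | .node c ts, x => evalList c ts x
def evalList {n : ℕ} : Bool → List (AT n) → (Fin n → Bool) → Bool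
  | c, [], _ => c
  | c, t :: ts, x => if c then eval t x && evalList c ts x
                     else eval t x || evalList c ts x
end

end AT

open AT

/-- Number of associative trees of size `m` in a family `𝒯`. -/
noncomputable def countIn (n : ℕ) (𝒯 : Set (AT n)) (m : ℕ) : ℕ :=
  Nat.card {t : AT n // t ∈ 𝒯 ∧ WF t ∧ size t = m}

/-- `A n m` is the number of associative trees of size `m` on `n` variables. -/
noncomputable def A (n m : ℕ) : ℕ := countIn n Set.univ m

/-- `Pmn n m f` is the proportion, among associative trees of size `m` on `n`
variables, of those computing the Boolean function `f`. -/
noncomputable def Pmn (n m : ℕ) (f : (Fin n → Bool) → Bool) : ℝ :=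
  (countIn n {t | eval t = f} m : ℝ) / (A n m : ℝ)

/-- Ratio of trees of size `m` in the family `𝒯` among all trees of size `m`. -/
noncomputable def ratio (n : ℕ) (𝒯 : Set (AT n)) (m : ℕ) : ℝ :=
  (countIn n 𝒯 m : ℝ) / (A n m : ℝ)

/-- `HasLimRatio n 𝒯 μ` : the limiting ratio of the family `𝒯` exists and is `μ`. -/
def HasLimRatio (n : ℕ) (𝒯 : Set (AT n)) (μ : ℝ) : Prop :=
  Filter.Tendsto (ratio n 𝒯) Filter.atTop (nhds μ)

/-- Extension of a Boolean function of `n₀` variables to `n ≥ n₀` variables. -/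
def extend {n₀ n : ℕ} (h : n₀ ≤ n) (f : (Fin n₀ → Bool) → Bool) :
    (Fin n → Bool) → Bool :=
  fun x => f (fun j => x (Fin.castLE h j))

open Classical in
/-- The tree size complexity of a Boolean function. -/
noncomputable def Lcomp (n : ℕ) (f : (Fin n → Bool) → Bool) : ℕ :=
  if f = (fun _ => true) ∨ f = (fun _ => false) then 0
  else if ∃ i : Fin n, f = (fun x => x i) ∨ f = (fun x => ! x i) then 2
  else sInf {m | ∃ t : AT n, WF t ∧ size t = m ∧ eval t = f}

/-- The family `𝒳` of simple `x` trees for a literal `x` (here a positive literal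
given by a variable index): trees whose root has exactly two children and is either
labelled `∨`, with one child the leaf `x` and the other a non-leaf subtree
computing the constant function `False`, or labelled `∧`, with one child the leaf
`x` and the other a non-leaf subtree computing the constant function `True`. -/
def SimpleX (n : ℕ) (x : Fin n) : Set (AT n) :=
  {t | ∃ s : AT n, isLeafB s = false ∧
    ((eval s = (fun _ => false) ∧
        (t = AT.node false [AT.leaf x true, s] ∨ t = AT.node false [s, AT.leaf x true])) ∨
      (eval s = (fun _ => true) ∧
        (t = AT.node true [AT.leaf x true, s] ∨ t = AT.node true [s, AT.leaf x true])))}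

namespace Stmt16
open PowerSeries Filter Topology

noncomputable def nu (m : ℕ) : ℝ := (catalan m : ℝ) / 4 ^ m

lemma cb_eq (m : ℕ) : ((m : ℝ) + 1) * catalan m = Nat.centralBinom m := by
  exact_mod_cast succ_mul_catalan_eq_centralBinom m

lemma cb_succ (m : ℕ) : ((m : ℝ) + 1) * Nat.centralBinom (m + 1)
    = 2 * (2 * m + 1) * Nat.centralBinom m := by
  exact_mod_cast Nat.succ_mul_centralBinom_succ m

lemma nu_eq (m : ℕ) : nu m = (Nat.centralBinom m : ℝ) / 4 ^ m / (m + 1) := by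
  have := cb_eq m
  have h : (m : ℝ) + 1 ≠ 0 := by positivity
  rw [nu, ← this]; field_simp

lemma nu_pos (m : ℕ) : 0 < nu m := by
  rw [nu_eq]
  have := Nat.centralBinom_pos m
  positivity

lemma nu_succ (m : ℕ) : nu (m + 1) = nu m * ((2 * m + 1) / (2 * m + 4)) := by
  rw [nu_eq, nu_eq]
  have h := cb_succ m
  have h1 : (Nat.centralBinom (m+1) : ℝ) = 2 * (2 * m + 1) * Nat.centralBinom m / (m + 1) := by
    field_simp; linarith
  rw [h1]; push_cast; field_simp; ring

lemma nu_zero : nu 0 = 1 := by simp [nu]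

lemma nu_anti : Antitone nu := by
  apply antitone_nat_of_succ_le
  intro m
  rw [nu_succ]
  have : ((2 * m + 1 : ℝ) / (2 * m + 4)) ≤ 1 := by
    rw [div_le_one (by positivity)]; linarith
  nlinarith [nu_pos m]

lemma nu_le_one (m : ℕ) : nu m ≤ 1 := by
  rw [← nu_zero]; exact nu_anti (Nat.zero_le m)

lemma nu_mono2 : Monotone (fun m : ℕ => ((m : ℝ) + 1) ^ 2 * nu m) := by
  apply monotone_nat_of_le_succ
  intro m
  rw [nu_succ]; push_cast
  have h : ((m : ℝ) + 1) ^ 2 ≤ ((m : ℝ) + 1 + 1) ^ 2 * ((2 * m + 1 : ℝ) / (2 * m + 4)) := by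
    rw [← mul_div_assoc, le_div_iff₀ (by positivity)]
    have : (0 : ℝ) ≤ m := by positivity
    nlinarith [mul_nonneg this this]
  nlinarith [nu_pos m]

lemma nu_ge (m : ℕ) : 1 ≤ ((m : ℝ) + 1) ^ 2 * nu m := by
  have := nu_mono2 (Nat.zero_le m)
  simpa [nu_zero] using this

lemma nu_half {i m : ℕ} (him : i ≤ m) (hm : m ≤ 2 * i) : nu i ≤ 4 * nu m := by
  have h := nu_mono2 him
  simp only at h
  have h1 : ((m : ℝ) + 1) ^ 2 ≤ 4 * ((i : ℝ) + 1) ^ 2 := by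
    have : (m : ℝ) ≤ 2 * i := by exact_mod_cast hm
    have h0 : (0 : ℝ) ≤ m := by positivity
    nlinarith
  have h2 : ((i : ℝ) + 1) ^ 2 * nu i ≤ ((i : ℝ) + 1) ^ 2 * (4 * nu m) := by
    nlinarith [nu_pos m]
  exact le_of_mul_le_mul_left h2 (by positivity)

lemma nu_summable : Summable nu := by
  apply summable_of_sum_range_le (c := 2) (fun m => (nu_pos m).le)
  intro k
  have : ∀ k, ∑ i ∈ Finset.range k, nu i = 2 - 2 * ((Nat.centralBinom k : ℝ) / 4 ^ k) := by
    intro k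
    induction k with
    | zero => simp
    | succ k ih =>
      rw [Finset.sum_range_succ, ih, nu_eq]
      have h := cb_succ k
      have h1 : (Nat.centralBinom (k+1) : ℝ) = 2 * (2 * k + 1) * Nat.centralBinom k / (k + 1) := by
        field_simp; linarith
      rw [h1, pow_succ]; field_simp; ring
  rw [this]
  have : (0:ℝ) ≤ (Nat.centralBinom k : ℝ) / 4 ^ k := by positivity
  linarith

lemma nu_ratio : Tendsto (fun m => nu m / nu (m + 1)) atTop (𝓝 1) := by
  have : (fun m => nu m / nu (m + 1)) = fun m : ℕ => 1 + (3 / 2) * (1 / ((m : ℝ) + 1 / 2)) := by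
    funext m
    rw [nu_succ]
    have := (nu_pos m).ne'
    field_simp; ring
  rw [this]
  have h : Tendsto (fun m : ℕ => (1 / ((m : ℝ) + 1 / 2))) atTop (𝓝 0) := by
    simp only [one_div]
    apply Tendsto.inv_tendsto_atTop
    exact tendsto_atTop_add_const_right _ _ tendsto_natCast_atTop_atTop
  simpa using (h.const_mul (3 / 2)).const_add 1

noncomputable def hat (x : ℝ⟦X⟧) : ℝ := ∑' m, coeff m x
noncomputable def nrm (x : ℝ⟦X⟧) : ℝ := ∑' m, |coeff m x|

def Asy (x : ℝ⟦X⟧) (l e : ℝ) : Prop :=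
  ∀ d > e, ∀ᶠ m in atTop, |coeff m x - l * nu m| ≤ d * nu m

lemma Asy.mono {x : ℝ⟦X⟧} {l e e' : ℝ} (h : Asy x l e) (he : e ≤ e') : Asy x l e' :=
  fun d hd => h d (lt_of_le_of_lt he hd)

lemma Asy.add {x y : ℝ⟦X⟧} {l e l' e' : ℝ} (h : Asy x l e) (h' : Asy y l' e') :
    Asy (x + y) (l + l') (e + e') := by
  intro d hd
  filter_upwards [h (e + (d - e - e') / 2) (by linarith),
    h' (e' + (d - e - e') / 2) (by linarith)] with m h1 h2
  rw [map_add]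
  have : coeff m x + coeff m y - (l + l') * nu m
      = (coeff m x - l * nu m) + (coeff m y - l' * nu m) := by ring
  rw [this]
  refine (abs_add_le _ _).trans ?_
  nlinarith

lemma Asy.smul {x : ℝ⟦X⟧} {l e : ℝ} (h : Asy x l e) (c : ℝ) :
    Asy (C c * x) (c * l) (|c| * e) := by
  intro d hd
  by_cases hc : c = 0
  · subst hc
    have hd0 : 0 < d := by simpa using hd
    filter_upwards with m
    simpa using mul_nonneg hd0.le (nu_pos m).le
  · have hc' : 0 < |c| := abs_pos.mpr hc
    filter_upwards [h (d / |c|) (by rw [gt_iff_lt, lt_div_iff₀ hc']; linarith)] with m hm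
    rw [coeff_C_mul, mul_assoc, ← mul_sub, abs_mul]
    calc _ ≤ |c| * (d / |c| * nu m) := by gcongr
      _ = d * nu m := by field_simp

lemma Asy.congr {x y : ℝ⟦X⟧} {l e : ℝ} (h : Asy x l e)
    (hxy : ∀ᶠ m in atTop, coeff m x = coeff m y) : Asy y l e := by
  intro d hd
  filter_upwards [h d hd, hxy] with m h1 h2
  rwa [← h2]

lemma Asy.X_mul {x : ℝ⟦X⟧} {l e : ℝ} (h : Asy x l e) : Asy (X * x) l e := by
  intro d hd
  have hd' : e < (d + e) / 2 := by linarith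
  have ht : Tendsto (fun m => (d + e) / 2 * (nu m / nu (m + 1))
      + |l| * (nu m / nu (m + 1) - 1)) atTop (𝓝 ((d + e) / 2 * 1 + |l| * (1 - 1))) :=
    (nu_ratio.const_mul _).add ((nu_ratio.sub_const 1).const_mul _)
  have h2 := ht.eventually_le_const (u := d) (by simp; linarith)
  rw [← map_add_atTop_eq_nat 1, eventually_map]
  filter_upwards [h _ hd', h2] with m h1 h2
  rw [coeff_succ_X_mul]
  have hp := nu_pos (m + 1)
  have h3 : (d + e) / 2 * nu m + |l| * (nu m - nu (m + 1)) ≤ d * nu (m + 1) := by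
    have := mul_le_mul_of_nonneg_right h2 hp.le
    refine le_trans (le_of_eq ?_) this
    field_simp
  have h4 : coeff m x - l * nu (m + 1) = (coeff m x - l * nu m) + l * (nu m - nu (m + 1)) := by
    ring
  rw [h4]
  refine (abs_add_le _ _).trans ?_
  rw [abs_mul, abs_of_nonneg (a := nu m - nu (m + 1)) (by linarith [nu_anti (Nat.le_succ m)])]
  linarith

lemma Asy.X_pow_mul {x : ℝ⟦X⟧} {l e : ℝ} (h : Asy x l e) (k : ℕ) : Asy (X ^ k * x) l e := by
  induction k with
  | zero => simpa using h
  | succ k ih => rw [pow_succ', mul_assoc]; exact ih.X_mul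

lemma asy_zero : Asy 0 0 0 := by
  intro d hd
  exact Eventually.of_forall fun m => by simpa using mul_nonneg (le_of_lt hd) (nu_pos m).le

lemma Asy.sum {ι : Type*} (s : Finset ι) (x : ι → ℝ⟦X⟧) (l e : ι → ℝ)
    (h : ∀ i ∈ s, Asy (x i) (l i) (e i)) :
    Asy (∑ i ∈ s, x i) (∑ i ∈ s, l i) (∑ i ∈ s, e i) := by
  classical
  induction s using Finset.induction_on with
  | empty => simpa using asy_zero
  | insert a s ha ih =>
    rw [Finset.sum_insert ha, Finset.sum_insert ha, Finset.sum_insert ha]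
    exact (h a (by simp)).add (ih fun i hi => h i (by simp [hi]))

lemma Asy.lim {x : ℝ⟦X⟧} {l e : ℝ} {u v : ℕ → ℝ} (h : ∀ k, Asy x (u k) (v k))
    (hu : Tendsto u atTop (𝓝 l)) (hv : Tendsto v atTop (𝓝 e)) : Asy x l e := by
  intro d hd
  have h1 := hv.eventually_le_const (u := e + (d - e) / 3) (by linarith)
  have h2 := (Metric.tendsto_nhds.mp hu) ((d - e) / 3) (by linarith)
  obtain ⟨k, hk1, hk2⟩ := (h1.and h2).exists
  filter_upwards [h k (e + 2 * (d - e) / 3) (by linarith)] with m hm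
  have : coeff m x - l * nu m = (coeff m x - u k * nu m) + (u k - l) * nu m := by ring
  rw [this]
  refine (abs_add_le _ _).trans ?_
  rw [abs_mul, abs_of_pos (nu_pos m)]
  rw [Real.dist_eq] at hk2
  have := mul_le_mul_of_nonneg_right hk2.le (nu_pos m).le
  nlinarith

lemma asy_of_bound {x : ℝ⟦X⟧} {c : ℝ} (h : ∀ m, |coeff m x| ≤ c * nu m) : Asy x 0 c := by
  intro d hd
  filter_upwards with m
  have := mul_le_mul_of_nonneg_right (le_of_lt hd) (nu_pos m).le
  simpa using (h m).trans this

lemma Asy.bound {x : ℝ⟦X⟧} {l e : ℝ} (h : Asy x l e) :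
    ∃ c, 0 ≤ c ∧ ∀ m, |coeff m x| ≤ c * nu m := by
  have h1 := h (e + 1) (by linarith)
  obtain ⟨M, hM⟩ := eventually_atTop.mp h1
  refine ⟨(|e| + 1 + |l|) + ∑ m ∈ Finset.range M, |coeff m x| / nu m, ?_, ?_⟩
  · have : 0 ≤ ∑ m ∈ Finset.range M, |coeff m x| / nu m :=
      Finset.sum_nonneg fun m _ => div_nonneg (abs_nonneg _) (nu_pos m).le
    positivity
  · intro m
    have hp := nu_pos m
    have hs : 0 ≤ ∑ m ∈ Finset.range M, |coeff m x| / nu m :=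
      Finset.sum_nonneg fun m _ => div_nonneg (abs_nonneg _) (nu_pos m).le
    by_cases hm : m < M
    · have := Finset.single_le_sum (f := fun m => |coeff m x| / nu m)
        (fun m _ => div_nonneg (abs_nonneg _) (nu_pos m).le) (Finset.mem_range.mpr hm)
      rw [← div_le_iff₀ hp]
      have : 0 ≤ |e| + 1 + |l| := by positivity
      linarith
    · have h2 := hM m (by omega)
      have h3 : coeff m x = (coeff m x - l * nu m) + l * nu m := by ring
      rw [h3]
      refine (abs_add_le _ _).trans ?_
      rw [abs_mul, abs_of_pos hp]
      have := mul_nonneg hs hp.le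
      have := mul_le_mul_of_nonneg_right (le_abs_self e) hp.le
      nlinarith

lemma summable_of_bound {x : ℝ⟦X⟧} {c : ℝ} (h : ∀ m, |coeff m x| ≤ c * nu m) :
    Summable fun m => |coeff m x| :=
  Summable.of_nonneg_of_le (fun _ => abs_nonneg _) h (nu_summable.mul_left c)

lemma Asy.summable {x : ℝ⟦X⟧} {l e : ℝ} (h : Asy x l e) : Summable fun m => |coeff m x| := by
  obtain ⟨c, -, hc⟩ := h.bound
  exact summable_of_bound hc

lemma hat_mul {x y : ℝ⟦X⟧} (hx : Summable fun m => |coeff m x|)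
    (hy : Summable fun m => |coeff m y|) : hat (x * y) = hat x * hat y := by
  have h := tsum_mul_tsum_eq_tsum_sum_antidiagonal_of_summable_norm
    (f := fun m => coeff m x) (g := fun m => coeff m y) hx hy
  unfold hat
  rw [h]
  exact tsum_congr fun m => coeff_mul m x y

lemma hat_add {x y : ℝ⟦X⟧} (hx : Summable fun m => |coeff m x|)
    (hy : Summable fun m => |coeff m y|) : hat (x + y) = hat x + hat y := by
  unfold hat
  simp only [map_add]
  exact hx.of_abs.tsum_add hy.of_abs

lemma nrm_eq_hat {x : ℝ⟦X⟧} (h : ∀ m, 0 ≤ coeff m x) : nrm x = hat x := by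
  unfold nrm hat
  simp only [abs_of_nonneg (h _)]

/-- head of a series -/
noncomputable def hd (K : ℕ) (x : ℝ⟦X⟧) : ℝ⟦X⟧ := ∑ i ∈ Finset.range K, C (coeff i x) * X ^ i

lemma coeff_hd (K m : ℕ) (x : ℝ⟦X⟧) : coeff m (hd K x) = if m < K then coeff m x else 0 := by
  unfold hd
  simp only [map_sum, coeff_C_mul, coeff_X_pow, mul_ite, mul_one, mul_zero]
  simp

lemma coeff_tl (K m : ℕ) (x : ℝ⟦X⟧) : coeff m (x - hd K x) = if m < K then 0 else coeff m x := by
  rw [map_sub, coeff_hd]; split_ifs <;> simp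

lemma asy_hd_mul {x y : ℝ⟦X⟧} {l e : ℝ} (K : ℕ) (h : Asy y l e) :
    Asy (hd K x * y) ((∑ i ∈ Finset.range K, coeff i x) * l)
      ((∑ i ∈ Finset.range K, |coeff i x|) * e) := by
  unfold hd
  rw [Finset.sum_mul, Finset.sum_mul, Finset.sum_mul]
  refine Asy.sum _ _ _ _ fun i _ => ?_
  rw [mul_assoc]
  exact (h.X_pow_mul i).smul _

lemma asy_tl {x : ℝ⟦X⟧} {l e : ℝ} (K : ℕ) (h : Asy x l e) : Asy (x - hd K x) l e := by
  refine h.congr ?_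
  filter_upwards [eventually_ge_atTop K] with m hm
  rw [coeff_tl, if_neg (by omega)]

lemma mid_bound {x y : ℝ⟦X⟧} {c c' : ℝ} (hc : 0 ≤ c) (hc' : 0 ≤ c')
    (hx : ∀ m, |coeff m x| ≤ c * nu m) (hy : ∀ m, |coeff m y| ≤ c' * nu m) (K m : ℕ) :
    |coeff m ((x - hd K x) * (y - hd K y))| ≤ (8 * c * c' * ∑' i, nu (i + K)) * nu m := by
  set f : ℕ → ℝ := fun i => if i < K then 0 else nu i with hf
  have hf0 : ∀ i, 0 ≤ f i := by
    intro i; simp only [hf]; split_ifs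
    · exact le_rfl
    · exact (nu_pos i).le
  have hfs : Summable f := Summable.of_nonneg_of_le hf0
    (fun i => by simp only [hf]; split_ifs; exacts [(nu_pos i).le, le_rfl]) nu_summable
  have hft : ∑' i, f i = ∑' i, nu (i + K) := by
    rw [← hfs.sum_add_tsum_nat_add K]
    rw [Finset.sum_eq_zero, zero_add]
    · apply tsum_congr; intro i; simp [hf]
    · intro i hi; simp [hf, Finset.mem_range.mp hi]
  have hX : ∀ i, |coeff i (x - hd K x)| ≤ c * f i := by
    intro i; rw [coeff_tl]; simp only [hf]; split_ifs
    · simp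
    · exact hx i
  have hY : ∀ i, |coeff i (y - hd K y)| ≤ c' * f i := by
    intro i; rw [coeff_tl]; simp only [hf]; split_ifs
    · simp
    · exact hy i
  have key : ∀ p ∈ Finset.HasAntidiagonal.antidiagonal m, f p.1 * f p.2 ≤ 4 * nu m * (f p.1 + f p.2) := by
    rintro ⟨i, j⟩ hp
    rw [Finset.HasAntidiagonal.mem_antidiagonal] at hp
    simp only at hp ⊢
    have hle : ∀ i, f i ≤ nu i := fun i => by
      simp only [hf]; split_ifs; exacts [(nu_pos i).le, le_rfl]
    have hm := nu_pos m
    rcases le_total i j with h | h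
    · have h1 := (hle j).trans (nu_half (i := j) (m := m) (by omega) (by omega))
      nlinarith [hf0 i, hf0 j, mul_nonneg hm.le (hf0 j), mul_le_mul_of_nonneg_left h1 (hf0 i)]
    · have h1 := (hle i).trans (nu_half (i := i) (m := m) (by omega) (by omega))
      nlinarith [hf0 i, hf0 j, mul_nonneg hm.le (hf0 i), mul_le_mul_of_nonneg_left h1 (hf0 j)]
  have hs1 : ∑ p ∈ Finset.HasAntidiagonal.antidiagonal m, f p.1 ≤ ∑' i, f i := by
    rw [Finset.Nat.sum_antidiagonal_eq_sum_range_succ_mk]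
    exact hfs.sum_le_tsum _ (fun i _ => hf0 i)
  have hs2 : ∑ p ∈ Finset.HasAntidiagonal.antidiagonal m, f p.2 ≤ ∑' i, f i := by
    rw [← Finset.Nat.sum_antidiagonal_swap]
    exact hs1
  rw [coeff_mul]
  calc _ ≤ ∑ p ∈ Finset.HasAntidiagonal.antidiagonal m, |coeff p.1 (x - hd K x) * coeff p.2 (y - hd K y)| :=
        Finset.abs_sum_le_sum_abs _ _
    _ ≤ ∑ p ∈ Finset.HasAntidiagonal.antidiagonal m, (c * c') * (4 * nu m * (f p.1 + f p.2)) := by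
        apply Finset.sum_le_sum
        intro p hp
        rw [abs_mul]
        calc _ ≤ (c * f p.1) * (c' * f p.2) := by
              gcongr
              · exact mul_nonneg hc (hf0 _)
              · exact hX _
              · exact hY _
          _ = (c * c') * (f p.1 * f p.2) := by ring
          _ ≤ _ := mul_le_mul_of_nonneg_left (key p hp) (mul_nonneg hc hc')
    _ = (c * c') * (4 * nu m * (∑ p ∈ Finset.HasAntidiagonal.antidiagonal m, f p.1
          + ∑ p ∈ Finset.HasAntidiagonal.antidiagonal m, f p.2)) := by
        rw [← Finset.mul_sum, ← Finset.mul_sum, Finset.sum_add_distrib]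
    _ ≤ (c * c') * (4 * nu m * (∑' i, f i + ∑' i, f i)) := by
        have := nu_pos m
        gcongr
    _ = _ := by rw [hft]; ring

theorem Asy.mul {x y : ℝ⟦X⟧} {l e l' e' : ℝ} (hx : Asy x l e) (hy : Asy y l' e') :
    Asy (x * y) (hat x * l' + hat y * l) (nrm x * e' + nrm y * e) := by
  obtain ⟨c, hc0, hc⟩ := hx.bound
  obtain ⟨c', hc0', hc'⟩ := hy.bound
  have hK : ∀ K, Asy (x * y)
      ((∑ i ∈ Finset.range K, coeff i x) * l' + (∑ i ∈ Finset.range K, coeff i y) * l + 0)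
      ((∑ i ∈ Finset.range K, |coeff i x|) * e' + (∑ i ∈ Finset.range K, |coeff i y|) * e
        + 8 * c * c' * ∑' i, nu (i + K)) := by
    intro K
    have h1 := asy_hd_mul (x := x) K hy
    have h2 := asy_hd_mul (x := y) K (asy_tl K hx)
    have h3 := asy_of_bound (mid_bound hc0 hc0' hc hc' K)
    have := (h1.add h2).add h3
    convert this using 1
    ring
  refine Asy.lim hK ?_ ?_
  · rw [← add_zero (hat x * l' + hat y * l)]
    refine Tendsto.add (Tendsto.add ?_ ?_) tendsto_const_nhds
    · exact (hx.summable.of_abs.hasSum.tendsto_sum_nat).mul_const _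
    · exact (hy.summable.of_abs.hasSum.tendsto_sum_nat).mul_const _
  · rw [← add_zero (nrm x * e' + nrm y * e)]
    refine Tendsto.add (Tendsto.add ?_ ?_) ?_
    · exact (hx.summable.hasSum.tendsto_sum_nat).mul_const _
    · exact (hy.summable.hasSum.tendsto_sum_nat).mul_const _
    · have := (tendsto_sum_nat_add nu).const_mul (8 * c * c')
      simpa using this

lemma Asy.tendsto {x : ℝ⟦X⟧} {l : ℝ} (h : Asy x l 0) :
    Tendsto (fun m => coeff m x / nu m) atTop (𝓝 l) := by
  rw [Metric.tendsto_nhds]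
  intro ε hε
  filter_upwards [h (ε / 2) (by simpa using hε)] with m hm
  rw [Real.dist_eq]
  have hp := nu_pos m
  have : coeff m x / nu m - l = (coeff m x - l * nu m) / nu m := by field_simp
  rw [this, abs_div, abs_of_pos hp, div_lt_iff₀ hp]
  nlinarith

lemma Asy.mul0 {x y : ℝ⟦X⟧} {l l' : ℝ} (hx : Asy x l 0) (hy : Asy y l' 0) :
    Asy (x * y) (hat x * l' + hat y * l) 0 := by
  simpa using hx.mul hy

/-- The contraction theorem. -/
theorem contraction {a g k : ℝ⟦X⟧} {ρ σ κ : ℝ} (hρ : 0 ≤ ρ) (hσ : |σ| ≤ 1)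
    (ha : ∀ m, 0 ≤ coeff m a) (hg : ∀ m, 0 ≤ coeff m g)
    (hab : ∃ c, ∀ m, coeff m a ≤ c * nu m)
    (hgk : g = k + C σ * a) (hk : Asy k κ 0)
    (heq : a = g * a + C ρ * (X * (g * g)))
    (hlt : hat a + 2 * ρ * hat g < 1 - hat g) :
    ∃ l, Asy a l 0 ∧ l * (1 - hat g) = (hat a + 2 * ρ * hat g) * (κ + σ * l) := by
  have ha0 : 0 ≤ hat a := tsum_nonneg ha
  have hg0 : 0 ≤ hat g := tsum_nonneg hg
  set q := hat a + 2 * ρ * hat g with hq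
  have hq0 : 0 ≤ q := by positivity
  have hden : 0 < 1 - hat g - σ * q := by
    have : σ * q ≤ 1 * q := by gcongr; exact (le_abs_self σ).trans hσ
    linarith
  set l := q * κ / (1 - hat g - σ * q) with hl
  have hleq : l * (1 - hat g) = q * (κ + σ * l) := by
    have : l * (1 - hat g - σ * q) = q * κ := by rw [hl, div_mul_cancel₀ _ hden.ne']
    linarith
  refine ⟨l, ?_, hleq⟩
  set c := hat g + q with hcdef
  have hc0 : 0 ≤ c := by positivity
  have hc1 : c < 1 := by linarith
  have step : ∀ ε, 0 ≤ ε → Asy a l ε → Asy a l (c * ε) := by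
    intro ε hε h
    have hgA : Asy g (κ + σ * l) ε := by
      have := (hk.add (h.smul σ))
      rw [← hgk] at this
      refine this.mono ?_
      nlinarith
    have h1 := hgA.mul h
    have h2 := ((hgA.mul hgA).X_mul).smul ρ
    have h3 := h1.add h2
    rw [← heq, nrm_eq_hat ha, nrm_eq_hat hg, abs_of_nonneg hρ] at h3
    convert h3 using 1
    · have : q * (κ + σ * l) = hat a * (κ + σ * l) + 2 * ρ * hat g * (κ + σ * l) := by
        rw [hq]; ring
      linarith
    · rw [hcdef, hq]; ring
  obtain ⟨c0, hc0b⟩ := hab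
  have start : Asy a l (|c0| + |l|) := by
    intro d hd
    filter_upwards with m
    have hp := nu_pos m
    refine (abs_sub _ _).trans ?_
    rw [abs_of_nonneg (ha m), abs_mul, abs_of_pos hp]
    have := hc0b m
    have h2 := mul_le_mul_of_nonneg_right (le_abs_self c0) hp.le
    have h3 := mul_le_mul_of_nonneg_right (le_of_lt hd) hp.le
    linarith
  have iter : ∀ j : ℕ, Asy a l (c ^ j * (|c0| + |l|)) := by
    intro j
    induction j with
    | zero => simpa using start
    | succ j ih =>
      have := step _ (by positivity) ih
      rwa [pow_succ', mul_assoc]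
  refine Asy.lim iter tendsto_const_nhds ?_
  have := (tendsto_pow_atTop_nhds_zero_of_lt_one hc0 hc1).mul_const (|c0| + |l|)
  simpa using this


lemma asy_of_finite {x : ℝ⟦X⟧} (h : ∀ᶠ m in atTop, coeff m x = 0) : Asy x 0 0 := by
  refine asy_zero.congr ?_
  filter_upwards [h] with m hm
  rw [hm]; simp

lemma asy_one : Asy 1 0 0 := by
  apply asy_of_finite
  filter_upwards [eventually_gt_atTop 0] with m hm
  rw [coeff_one, if_neg hm.ne']

lemma asy_X : Asy X 0 0 := by
  simpa using asy_one.X_mul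

lemma asy_geom {x : ℝ⟦X⟧} {r : ℝ} (hr : |r| < 1) (h : ∀ m, |coeff m x| ≤ |r| ^ m) :
    Asy x 0 0 := by
  intro d hd
  have h1 : Tendsto (fun m : ℕ => ((m : ℝ) + 1) ^ 2 * |r| ^ m) atTop (𝓝 0) := by
    have h2 := tendsto_pow_const_mul_const_pow_of_abs_lt_one 2 (r := |r|) (by simpa using hr)
    have h3 := tendsto_pow_const_mul_const_pow_of_abs_lt_one 1 (r := |r|) (by simpa using hr)
    have h4 := tendsto_pow_const_mul_const_pow_of_abs_lt_one 0 (r := |r|) (by simpa using hr)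
    have := (h2.add (h3.const_mul 2)).add h4
    simp only [mul_zero, add_zero] at this
    refine this.congr fun m => ?_
    ring
  filter_upwards [h1.eventually_le_const hd] with m hm
  rw [zero_mul, sub_zero]
  refine (h m).trans ?_
  have h5 := nu_ge m
  have hp : (0 : ℝ) < ((m : ℝ) + 1) ^ 2 := by positivity
  have h6 : |r| ^ m ≤ d / ((m : ℝ) + 1) ^ 2 := by
    rw [le_div_iff₀ hp]; linarith
  have h7 : 1 / ((m : ℝ) + 1) ^ 2 ≤ nu m := by
    rw [div_le_iff₀ hp]; linarith
  calc _ ≤ d * (1 / ((m : ℝ) + 1) ^ 2) := by rw [mul_one_div]; exact h6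
    _ ≤ _ := by have : 0 ≤ d := le_of_lt hd
                gcongr

noncomputable def nuS : ℝ⟦X⟧ := PowerSeries.mk nu

lemma asy_nuS : Asy nuS 1 0 := by
  intro d hd
  filter_upwards with m
  have := mul_nonneg (le_of_lt hd) (nu_pos m).le
  simpa [nuS] using this

lemma nuS_eq : nuS = 1 + C (1 / 4) * (X * (nuS * nuS)) := by
  ext m
  cases m with
  | zero => simp [nuS, nu_zero]
  | succ m =>
    rw [map_add, coeff_C_mul, coeff_succ_X_mul, coeff_mul, coeff_one, if_neg (by omega)]
    simp only [nuS, coeff_mk, nu]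
    rw [catalan_succ']
    push_cast
    rw [Finset.sum_div, Finset.mul_sum, zero_add]
    apply Finset.sum_congr rfl
    rintro ⟨i, j⟩ hp
    rw [Finset.HasAntidiagonal.mem_antidiagonal] at hp
    simp only at hp ⊢
    rw [← hp, pow_succ, pow_add]
    field_simp

lemma sqrt_one (c : ℝ) : (1 - C (c / 2) * (X * rescale c nuS)) ^ 2 = 1 - C c * X := by
  have h := congrArg (rescale c) nuS_eq
  simp only [map_add, map_mul, map_one, rescale_X] at h
  have hC : rescale c (C (1 / 4 : ℝ)) = C (1 / 4) := by
    ext m; rw [coeff_rescale, coeff_C]; split_ifs with hm <;> simp [hm]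
  rw [hC] at h
  have h4 : (C (1 / 4 : ℝ) : ℝ⟦X⟧) * 4 = 1 := by
    rw [show (4 : ℝ⟦X⟧) = C 4 from (map_ofNat C 4).symm, ← map_mul]; norm_num
  have h2 : (C (c / 2) : ℝ⟦X⟧) * 2 = C c := by
    rw [show (2 : ℝ⟦X⟧) = C 2 from (map_ofNat C 2).symm, ← map_mul]; congr 1; ring
  generalize rescale c nuS = u at *
  generalize (C (1 / 4 : ℝ) : ℝ⟦X⟧) = p at *
  generalize (C (c / 2) : ℝ⟦X⟧) = w at *
  generalize (C c : ℝ⟦X⟧) = v at *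
  subst h2
  linear_combination (-2 * w * X) * h - (w ^ 2 * X ^ 2 * u * u) * h4

lemma hat_C_mul (c : ℝ) (x : ℝ⟦X⟧) : hat (C c * x) = c * hat x := by
  unfold hat; simp only [coeff_C_mul]; exact tsum_mul_left

lemma hat_one : hat 1 = 1 := by
  unfold hat
  rw [tsum_eq_single 0]
  · simp
  · intro m hm; rw [coeff_one, if_neg hm]

lemma hat_X : hat X = 1 := by
  unfold hat
  rw [tsum_eq_single 1]
  · simp
  · intro m hm; rw [coeff_X, if_neg hm]

theorem base {s ρ c : ℝ} (hs : 1 < s) (hρ : ρ = 1 / (s * (s + 2))) (hc : c = s / (s + 2))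
    {T N : ℝ⟦X⟧} (hT : ∀ m, 0 ≤ coeff m T) (hT0 : coeff 0 T = 0)
    (hTN : T = C c * X + N) (hN : N = T * N + C ρ * (X * (T * T))) :
    (∃ L, 0 < L ∧ Asy N L 0) ∧ hat T = s / (s + 1) := by
  have hρ0 : 0 < ρ := by rw [hρ]; positivity
  have hρ1 : ρ < 1 := by
    rw [hρ, div_lt_one (by positivity)]; nlinarith
  set β : ℝ := (s - 2) / (s + 2) with hβ
  have hβ1 : |β| < 1 := by
    rw [abs_lt, hβ]; constructor
    · rw [lt_div_iff₀ (by positivity)]; linarith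
    · rw [div_lt_one (by positivity)]; linarith
  have e1 : 1 + β = 2 * c := by rw [hβ, hc]; field_simp; ring
  have e2 : β = c ^ 2 - 4 * c * ρ := by rw [hβ, hc, hρ]; field_simp; ring
  set R : ℝ⟦X⟧ := 1 - C (1 / 2) * (X * nuS) with hR
  set Q : ℝ⟦X⟧ := 1 - C (β / 2) * (X * rescale β nuS) with hQ
  have hR2 : R ^ 2 = 1 - X := by
    have := sqrt_one 1
    rw [map_one, one_mul, rescale_one, RingHom.id_apply] at this
    exact this
  have hQ2 : Q ^ 2 = 1 - C β * X := sqrt_one β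
  have E1 : (1 : ℝ⟦X⟧) + C β = 2 * C c := by
    rw [show (2 : ℝ⟦X⟧) = C 2 from (map_ofNat C 2).symm, ← map_mul, ← e1]; simp
  have E2 : (C β : ℝ⟦X⟧) = C c ^ 2 - 4 * C c * C ρ := by
    rw [show (4 : ℝ⟦X⟧) = C 4 from (map_ofNat C 4).symm, ← map_mul, ← map_mul, ← map_pow,
      ← map_sub, ← e2]
  have quad : (1 + C ρ * X) * T ^ 2 - (1 + C c * X) * T + C c * X = 0 := by
    have hN' : N = T - C c * X := by rw [hTN]; ring
    rw [hN'] at hN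
    linear_combination -hN
  have sq : (2 * (1 + C ρ * X) * T - (1 + C c * X)) ^ 2 = (R * Q) ^ 2 := by
    rw [mul_pow, hR2, hQ2]
    linear_combination (4 * (1 + C ρ * X)) * quad + X * E1 - X ^ 2 * E2
  have lin : 2 * (1 + C ρ * X) * T - (1 + C c * X) = - (R * Q) := by
    rcases sq_eq_sq_iff_eq_or_eq_neg.mp sq with h | h
    · exfalso
      have := congrArg (constantCoeff (R := ℝ)) h
      have hT0' : constantCoeff T = 0 := by simpa using hT0
      simp [hR, hQ, hT0'] at this
      norm_num at this
    · exact h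
  set I : ℝ⟦X⟧ := PowerSeries.mk fun k => (-ρ) ^ k with hI
  have hIinv : (1 + C ρ * X) * I = 1 := by
    ext m
    cases m with
    | zero => simp [hI]
    | succ m =>
      rw [add_mul, one_mul, mul_assoc, map_add, coeff_C_mul, coeff_succ_X_mul, coeff_one,
        if_neg (by omega), hI, coeff_mk, coeff_mk, pow_succ]
      ring
  have h2 : (C (1 / 2 : ℝ) : ℝ⟦X⟧) * 2 = 1 := by
    rw [show (2 : ℝ⟦X⟧) = C 2 from (map_ofNat C 2).symm, ← map_mul]; norm_num
  have expl : T = C (1 / 2) * (I * (1 + C c * X + (C (-1) * Q + C (1 / 2) * (X * (nuS * Q))))) := by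
    have hm1 : (C (-1 : ℝ) : ℝ⟦X⟧) = -1 := by simp
    rw [hm1]
    have : 2 * (1 + C ρ * X) * T = 1 + C c * X - Q + C (1 / 2) * (X * (nuS * Q)) := by
      have := lin
      rw [hR] at this
      linear_combination this
    linear_combination (-T * 2 * C (1 / 2)) * hIinv - T * h2 + (C (1 / 2) * I) * this
  have aQ0 : Asy (rescale β nuS) 0 0 := by
    apply asy_geom hβ1
    intro m
    rw [coeff_rescale, abs_mul, abs_pow]
    have : |coeff m nuS| ≤ 1 := by
      rw [nuS, coeff_mk, abs_of_pos (nu_pos m)]; exact nu_le_one m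
    have h0 : 0 ≤ |β| ^ m := by positivity
    nlinarith
  have hQ' : Q = 1 + C (-(β / 2)) * (X * rescale β nuS) := by
    rw [hQ, map_neg]; ring
  have aQ : Asy Q 0 0 := by
    have := asy_one.add ((aQ0.X_mul).smul (-(β / 2)))
    rw [← hQ'] at this
    simpa using this
  have aI : Asy I 0 0 := by
    apply asy_geom (r := ρ) (by rw [abs_of_pos hρ0]; exact hρ1)
    intro m
    rw [hI, coeff_mk, abs_pow, abs_neg]
  have aIn := ((asy_one.add (asy_X.smul c)).add
    ((aQ.smul (-1)).add (((asy_nuS.mul0 aQ).X_mul).smul (1 / 2))))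
  have aT0 := (aI.mul aIn).smul (1 / 2)
  rw [← expl] at aT0
  have aT : Asy T (1 / 4 * (hat I * hat Q)) 0 := by
    convert aT0 using 1 <;> simp
    ring
  have hIhat : (1 + ρ) * hat I = 1 := by
    have a1 := asy_one.add (asy_X.smul ρ)
    have := hat_mul a1.summable aI.summable
    rw [hIinv, hat_one, hat_add asy_one.summable (asy_X.smul ρ).summable, hat_one, hat_C_mul,
      hat_X] at this
    linarith
  have hQhat : hat Q ^ 2 = 1 - β := by
    have h1 := hat_mul aQ.summable aQ.summable
    have hQ2' : Q * Q = 1 + C (-β) * X := by rw [← pow_two, hQ2, map_neg]; ring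
    rw [hQ2', hat_add asy_one.summable (asy_X.smul (-β)).summable, hat_one, hat_C_mul,
      hat_X] at h1
    linarith
  have hL0 : 0 ≤ 1 / 4 * (hat I * hat Q) :=
    ge_of_tendsto' aT.tendsto fun m => div_nonneg (hT m) (nu_pos m).le
  have hLne : 1 / 4 * (hat I * hat Q) ≠ 0 := by
    have h1 : hat I ≠ 0 := by rintro h; rw [h] at hIhat; simp at hIhat
    have h2 : hat Q ≠ 0 := by
      rintro h; rw [h] at hQhat
      have := (abs_lt.mp hβ1).2
      norm_num at hQhat; linarith
    positivity
  have aN : Asy N (1 / 4 * (hat I * hat Q)) 0 := by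
    have hN' : N = T + C (-c) * X := by rw [hTN, map_neg]; ring
    have := aT.add (asy_X.smul (-c))
    rw [← hN'] at this
    simpa using this
  refine ⟨⟨_, lt_of_le_of_ne hL0 hLne.symm, aN⟩, ?_⟩
  have hTh : hat T = c + hat N := by
    have : hat T = hat (C c * X + N) := by rw [← hTN]
    rw [this, hat_add (asy_X.smul c).summable aN.summable, hat_C_mul, hat_X, mul_one]
  have hNh : hat N = hat T * hat N + ρ * (hat T * hat T) := by
    have tt := aT.mul0 aT
    have h : hat N = hat (T * N + C ρ * (X * (T * T))) := by rw [← hN]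
    refine h.trans ?_
    rw [hat_add (aT.mul0 aN).summable ((tt.X_mul).smul ρ).summable, hat_C_mul,
      hat_mul asy_X.summable tt.summable, hat_mul aT.summable aT.summable,
      hat_mul aT.summable aN.summable, hat_X, one_mul]
  have hNh' : hat N = hat T - c := by linarith
  rw [hNh'] at hNh
  have h0 : (1 + ρ) * (hat T - s / (s + 1)) ^ 2 = 0 := by
    have f1 : (1 + ρ) * (2 * (s / (s + 1))) = 1 + c := by
      rw [hρ, hc]; field_simp; ring
    have f2 : (1 + ρ) * (s / (s + 1)) ^ 2 = c := by
      rw [hρ, hc]; field_simp; ring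
    linear_combination -hNh - hat T * f1 + f2
  have : (hat T - s / (s + 1)) ^ 2 = 0 := by
    rcases mul_eq_zero.mp h0 with h | h
    · linarith
    · exact h
  have := pow_eq_zero_iff (two_ne_zero) |>.mp this
  linarith

end Stmt16

namespace Stmt16
open AT PowerSeries Filter Topology

mutual
def neg {n : ℕ} : AT n → AT n
  | .leaf i b => .leaf i (!b)
  | .node c ts => .node (!c) (negList ts)
def negList {n : ℕ} : List (AT n) → List (AT n)
  | [] => []
  | t :: ts => neg t :: negList ts
end

lemma negList_eq {n : ℕ} (ts : List (AT n)) : negList ts = ts.map neg := by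
  induction ts with
  | nil => rfl
  | cons t ts ih => simp [negList, ih]

mutual
theorem neg_neg' {n : ℕ} : ∀ t : AT n, neg (neg t) = t
  | .leaf i b => by simp [neg]
  | .node c ts => by simp [neg, negList_neg ts]
theorem negList_neg {n : ℕ} : ∀ ts : List (AT n), negList (negList ts) = ts
  | [] => rfl
  | t :: ts => by simp [negList, neg_neg' t, negList_neg ts]
end

mutual
theorem size_neg {n : ℕ} : ∀ t : AT n, size (neg t) = size t
  | .leaf i b => by simp [neg, size]
  | .node c ts => by simp [neg, size, sizeList_neg ts]
theorem sizeList_neg {n : ℕ} : ∀ ts : List (AT n), sizeList (negList ts) = sizeList ts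
  | [] => rfl
  | t :: ts => by simp [negList, sizeList, size_neg t, sizeList_neg ts]
end

mutual
theorem eval_neg {n : ℕ} (x : Fin n → Bool) : ∀ t : AT n, eval (neg t) x = !(eval t x)
  | .leaf i b => by cases b <;> simp [neg, eval]
  | .node c ts => by simp [neg, eval, evalList_neg x c ts]
theorem evalList_neg {n : ℕ} (x : Fin n → Bool) (c : Bool) :
    ∀ ts : List (AT n), evalList (!c) (negList ts) x = !(evalList c ts x)
  | [] => by simp [negList, evalList]
  | t :: ts => by
    have h := evalList_neg x c ts
    cases c <;> simp only [Bool.not_false, Bool.not_true] at h <;>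
      simp [negList, evalList, eval_neg x t, h]
end

lemma rootConn_neg {n : ℕ} (t : AT n) : rootConn (neg t) = (rootConn t).map (! ·) := by
  cases t <;> simp [neg, rootConn]

lemma rootConn_neg_iff {n : ℕ} (t : AT n) (c : Bool) :
    rootConn (neg t) = some (!c) ↔ rootConn t = some c := by
  cases t <;> simp [neg, rootConn]

theorem WF_neg {n : ℕ} {t : AT n} (h : WF t) : WF (neg t) := by
  induction h with
  | leaf i b => exact WF.leaf _ _
  | node c ts hl hw hr ih =>
    rw [neg, negList_eq]
    refine WF.node _ _ (by simpa using hl) ?_ ?_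
    · intro t ht
      obtain ⟨s, hs, rfl⟩ := List.mem_map.mp ht
      exact ih s hs
    · intro t ht
      obtain ⟨s, hs, rfl⟩ := List.mem_map.mp ht
      rw [Ne, rootConn_neg_iff]
      exact hr s hs

lemma WF_neg_iff {n : ℕ} {t : AT n} : WF (neg t) ↔ WF t :=
  ⟨fun h => by simpa [neg_neg'] using WF_neg h, WF_neg⟩

lemma size_pos {n : ℕ} (t : AT n) : 1 ≤ size t := by
  cases t <;> simp [size]

lemma finite_le {n : ℕ} (m : ℕ) :
    {t : AT n | size t ≤ m}.Finite ∧ {ts : List (AT n) | sizeList ts ≤ m}.Finite := by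
  induction m with
  | zero =>
    constructor
    · convert Set.finite_empty
      ext t; have := size_pos t; simp; omega
    · refine (Set.finite_singleton ([] : List (AT n))).subset ?_
      intro ts h
      cases ts with
      | nil => simp
      | cons t ts => have := size_pos t; simp [sizeList] at h; omega
  | succ m ih =>
    have h1 : {t : AT n | size t ≤ m + 1}.Finite := by
      refine ((Set.finite_range (fun p : Fin n × Bool => AT.leaf p.1 p.2)).union
        (Set.Finite.image2 AT.node (Set.finite_univ) ih.2)).subset ?_
      intro t h
      cases t with
      | leaf i b => left; exact ⟨(i, b), rfl⟩
      | node c ts =>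
        right
        refine ⟨c, trivial, ts, ?_, rfl⟩
        simp [size] at h ⊢; omega
    refine ⟨h1, ((Set.finite_singleton ([] : List (AT n))).union
      (Set.Finite.image2 List.cons h1 ih.2)).subset ?_⟩
    intro ts h
    cases ts with
    | nil => simp
    | cons t ts =>
      right
      have := size_pos t
      simp [sizeList] at h
      refine ⟨t, ?_, ts, ?_, rfl⟩ <;> simp <;> omega

lemma finite_P {n : ℕ} (P : AT n → Prop) (m : ℕ) :
    {t : AT n | P t ∧ WF t ∧ size t = m}.Finite :=
  (finite_le m).1.subset fun _ h => h.2.2.le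

noncomputable def F {n : ℕ} (P : AT n → Prop) (m : ℕ) : Finset (AT n) := (finite_P P m).toFinset

lemma mem_F {n : ℕ} {P : AT n → Prop} {m : ℕ} {t : AT n} :
    t ∈ F P m ↔ P t ∧ WF t ∧ size t = m := by simp [F]

lemma countIn_eq {n : ℕ} (P : AT n → Prop) (m : ℕ) : countIn n {t | P t} m = (F P m).card := by
  rw [countIn, F, ← Set.ncard_eq_toFinset_card _ (finite_P P m)]
  rfl

noncomputable def gf {n : ℕ} (P : AT n → Prop) : ℝ⟦X⟧ := PowerSeries.mk fun m => ((F P m).card : ℝ)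

lemma coeff_gf {n : ℕ} (P : AT n → Prop) (m : ℕ) : coeff m (gf P) = ((F P m).card : ℝ) := by
  simp [gf]

open Classical in
noncomputable def PF {n : ℕ} (P Q : AT n → Prop) (m : ℕ) : Finset (AT n × AT n) :=
  (Finset.HasAntidiagonal.antidiagonal m).biUnion fun p => F P p.1 ×ˢ F Q p.2

lemma mem_PF {n : ℕ} {P Q : AT n → Prop} {m : ℕ} {t s : AT n} :
    (t, s) ∈ PF P Q m ↔ (P t ∧ WF t) ∧ (Q s ∧ WF s) ∧ size t + size s = m := by
  simp only [PF, Finset.mem_biUnion, Finset.mem_product, mem_F,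
    Finset.HasAntidiagonal.mem_antidiagonal]
  constructor
  · rintro ⟨⟨i, j⟩, h, ⟨h1, h2, h3⟩, h4, h5, h6⟩
    simp only at h h3 h6
    exact ⟨⟨h1, h2⟩, ⟨h4, h5⟩, by omega⟩
  · rintro ⟨⟨h1, h2⟩, ⟨h4, h5⟩, h⟩
    exact ⟨(size t, size s), h, ⟨h1, h2, rfl⟩, h4, h5, rfl⟩

lemma coeff_gf_mul {n : ℕ} (P Q : AT n → Prop) (m : ℕ) :
    coeff m (gf P * gf Q) = ((PF P Q m).card : ℝ) := by
  classical
  rw [coeff_mul, PF, Finset.card_biUnion]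
  · simp only [coeff_gf, Finset.card_product]
    push_cast
    rfl
  · intro p _ q _ hpq
    rw [Function.onFun, Finset.disjoint_left]
    rintro ⟨t, s⟩ h1 h2
    simp only [Finset.mem_product, mem_F] at h1 h2
    apply hpq
    ext
    · rw [← h1.1.2.2, ← h2.1.2.2]
    · rw [← h1.2.2.2, ← h2.2.2.2]

/-- AND-rooted trees true on `S`. -/
def aP {n : ℕ} (S : Finset (Fin n → Bool)) (t : AT n) : Prop :=
  rootConn t = some true ∧ ∀ σ ∈ S, eval t σ = true
/-- OR-rooted trees true on `S`. -/
def bP {n : ℕ} (S : Finset (Fin n → Bool)) (t : AT n) : Prop :=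
  rootConn t = some false ∧ ∀ σ ∈ S, eval t σ = true
/-- OR-rooted trees false on `S`. -/
def nP {n : ℕ} (S : Finset (Fin n → Bool)) (t : AT n) : Prop :=
  rootConn t = some false ∧ ∀ σ ∈ S, eval t σ = false
/-- leaves true on `S`. -/
def lP {n : ℕ} (S : Finset (Fin n → Bool)) (t : AT n) : Prop :=
  rootConn t = none ∧ ∀ σ ∈ S, eval t σ = true
/-- leaves and OR-rooted trees true on `S`. -/
def gP {n : ℕ} (S : Finset (Fin n → Bool)) (t : AT n) : Prop :=
  rootConn t ≠ some true ∧ ∀ σ ∈ S, eval t σ = true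

lemma WF_node {n : ℕ} {c : Bool} {ts : List (AT n)} : WF (.node c ts) ↔
    2 ≤ ts.length ∧ (∀ t ∈ ts, WF t) ∧ (∀ t ∈ ts, rootConn t ≠ some c) := by
  constructor
  · intro h; cases h with
    | node _ _ h1 h2 h3 => exact ⟨h1, h2, h3⟩
  · rintro ⟨h1, h2, h3⟩; exact WF.node c ts h1 h2 h3

lemma F_aP {n : ℕ} (S : Finset (Fin n → Bool)) (m : ℕ) :
    (F (aP S) (m + 1)).card = (PF (gP S) (aP S) (m + 1)).card + (PF (gP S) (gP S) m).card := by
  classical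
  have h1 : ((PF (gP S) (aP S) (m + 1)).image
      fun p => AT.node true (p.1 :: rootChildren p.2)).card = (PF (gP S) (aP S) (m + 1)).card := by
    apply Finset.card_image_of_injOn
    rintro ⟨t, s⟩ h ⟨t', s'⟩ h' heq
    rw [Finset.mem_coe, mem_PF] at h h'
    obtain ⟨-, ⟨⟨hs, -⟩, -⟩, -⟩ := h
    obtain ⟨-, ⟨⟨hs', -⟩, -⟩, -⟩ := h'
    cases s with
    | leaf => simp [rootConn] at hs
    | node c ts =>
      cases s' with
      | leaf => simp [rootConn] at hs'
      | node c' ts' =>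
        simp [rootConn, rootChildren] at *
        simp [hs, hs', heq]
  have h2 : ((PF (gP S) (gP S) m).image
      fun p => AT.node true [p.1, p.2]).card = (PF (gP S) (gP S) m).card := by
    apply Finset.card_image_of_injective
    rintro ⟨t, s⟩ ⟨t', s'⟩ heq
    simpa using heq
  rw [← h1, ← h2, ← Finset.card_union_of_disjoint]
  · congr 1
    ext t
    simp only [Finset.mem_union, Finset.mem_image, Prod.exists, mem_PF, mem_F]
    constructor
    · rintro ⟨⟨hr, he⟩, hw, hsz⟩
      cases t with
      | leaf => simp [rootConn] at hr
      | node c ts =>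
        simp only [rootConn, Option.some.injEq] at hr
        subst hr
        rw [WF_node] at hw
        obtain ⟨hl, hw1, hw2⟩ := hw
        match ts, hl with
        | [t, s], _ =>
          right
          refine ⟨t, s, ⟨⟨⟨hw2 t (by simp), ?_⟩, hw1 t (by simp)⟩,
            ⟨⟨hw2 s (by simp), ?_⟩, hw1 s (by simp)⟩, ?_⟩, rfl⟩
          · intro σ hσ
            have := he σ hσ
            simp [eval, evalList] at this
            exact this.1
          · intro σ hσ
            have := he σ hσ
            simp [eval, evalList] at this
            exact this.2
          · simp [size, sizeList] at hsz; omega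
        | t :: s :: r :: ts, _ =>
          left
          refine ⟨t, .node true (s :: r :: ts), ⟨⟨⟨hw2 t (by simp), ?_⟩, hw1 t (by simp)⟩,
            ⟨⟨rfl, ?_⟩, ?_⟩, ?_⟩, rfl⟩
          · intro σ hσ
            have := he σ hσ
            simp [eval, evalList] at this
            exact this.1
          · intro σ hσ
            have := he σ hσ
            simp [eval, evalList] at this ⊢
            exact this.2
          · rw [WF_node]
            refine ⟨by simp, fun u hu => hw1 u (List.mem_cons_of_mem _ hu),
              fun u hu => hw2 u (List.mem_cons_of_mem _ hu)⟩
          · simp [size, sizeList] at hsz ⊢; omega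
    · rintro (⟨t, s, ⟨⟨⟨ht1, ht2⟩, ht3⟩, ⟨⟨hs1, hs2⟩, hs3⟩, hsz⟩, rfl⟩ |
        ⟨t, s, ⟨⟨⟨ht1, ht2⟩, ht3⟩, ⟨⟨hs1, hs2⟩, hs3⟩, hsz⟩, rfl⟩)
      · cases s with
        | leaf => simp [rootConn] at hs1
        | node c ts =>
          simp only [rootConn, Option.some.injEq] at hs1
          subst hs1
          rw [WF_node] at hs3
          obtain ⟨hl, hw1, hw2⟩ := hs3
          refine ⟨⟨rfl, ?_⟩, ?_, ?_⟩
          · intro σ hσ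
            have h1 := ht2 σ hσ
            have h2 := hs2 σ hσ
            simp [eval] at h2
            simp [eval, evalList, rootChildren, h1, h2]
          · rw [WF_node]
            simp only [rootChildren]
            refine ⟨by simp; omega, ?_, ?_⟩
            · intro u hu
              rcases List.mem_cons.mp hu with rfl | hu
              · exact ht3
              · exact hw1 u hu
            · intro u hu
              rcases List.mem_cons.mp hu with rfl | hu
              · exact ht1
              · exact hw2 u hu
          · simp [size, sizeList, rootChildren] at hsz ⊢; omega
      · refine ⟨⟨rfl, ?_⟩, ?_, ?_⟩
        · intro σ hσ
          simp [eval, evalList, ht2 σ hσ, hs2 σ hσ]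
        · rw [WF_node]
          refine ⟨by simp, ?_, ?_⟩ <;> simp [*]
        · simp [size, sizeList]; omega
  · rw [Finset.disjoint_left]
    intro u hu hu'
    simp only [Finset.mem_image, Prod.exists, mem_PF] at hu hu'
    obtain ⟨t, s, ⟨-, ⟨⟨hs1, -⟩, hs⟩, -⟩, rfl⟩ := hu
    obtain ⟨t', s', -, h⟩ := hu'
    cases s with
    | leaf => simp [rootConn] at hs1
    | node c ts =>
      rw [WF_node] at hs
      simp only [rootChildren, AT.node.injEq, true_and, List.cons.injEq] at h
      have := hs.1
      rw [← h.2] at this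
      simp at this

lemma F_zero {n : ℕ} (P : AT n → Prop) : F P 0 = ∅ := by
  ext t; rw [mem_F]; have := size_pos t; simp; intros; omega

lemma gf_aP {n : ℕ} (S : Finset (Fin n → Bool)) :
    gf (aP S) = gf (gP S) * gf (aP S) + X * (gf (gP S) * gf (gP S)) := by
  ext m
  cases m with
  | zero => simp [F_zero, gf]
  | succ m =>
    rw [map_add, coeff_succ_X_mul, coeff_gf_mul, coeff_gf_mul, coeff_gf, F_aP]
    push_cast; rfl

lemma F_neg {n : ℕ} {P Q : AT n → Prop} (h : ∀ t, P (neg t) ↔ Q t) (m : ℕ) :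
    (F P m).card = (F Q m).card := by
  symm
  refine Finset.card_bij (fun t _ => neg t) ?_ ?_ ?_
  · intro t ht
    rw [mem_F] at ht ⊢
    exact ⟨(h t).mpr ht.1, WF_neg ht.2.1, by rw [size_neg]; exact ht.2.2⟩
  · intro t _ s _ hts
    simpa [neg_neg'] using congrArg neg hts
  · intro t ht
    rw [mem_F] at ht
    refine ⟨neg t, ?_, neg_neg' t⟩
    rw [mem_F]
    refine ⟨(h _).mp (by rw [neg_neg']; exact ht.1), WF_neg ht.2.1, by rw [size_neg]; exact ht.2.2⟩

lemma F_nP {n : ℕ} (S : Finset (Fin n → Bool)) (m : ℕ) :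
    (F (nP S) m).card = (F (aP S) m).card := by
  apply F_neg
  intro t
  simp only [nP, aP]
  rw [show (some false : Option Bool) = some (!true) from rfl, rootConn_neg_iff]
  simp [eval_neg]

lemma gf_bP {n : ℕ} (S : Finset (Fin n → Bool)) :
    gf (bP S) = ∑ R ∈ S.powerset, C ((-1 : ℝ) ^ R.card) * gf (aP R) := by
  classical
  ext m
  rw [map_sum]
  simp only [coeff_C_mul, coeff_gf, ← F_nP]
  have hb : F (bP S) m = (F (fun t => rootConn t = some false) m).filter
    (fun t => ∀ σ ∈ S, eval t σ = true) := by
    ext t; simp only [Finset.mem_filter, mem_F, bP]; tauto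
  have hn : ∀ R, F (nP R) m = (F (fun t : AT n => rootConn t = some false) m).filter
    (fun t => ∀ σ ∈ R, eval t σ = false) := by
    intro R; ext t; simp only [Finset.mem_filter, mem_F, nP]; tauto
  rw [hb]
  simp only [hn, Finset.card_filter]
  push_cast
  simp only [Finset.mul_sum]
  rw [Finset.sum_comm]
  apply Finset.sum_congr rfl
  intro t _
  have h1 : ∀ σ ∈ S, (if eval t σ = true then (1 : ℝ) else 0)
      = 1 + (if eval t σ = false then (-1) else 0) := by
    intro σ _
    cases eval t σ <;> simp
  have h2 : (if ∀ σ ∈ S, eval t σ = true then (1 : ℝ) else 0)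
      = ∏ σ ∈ S, (if eval t σ = true then (1 : ℝ) else 0) := by
    rw [Finset.prod_ite_zero]; simp
  rw [h2, Finset.prod_congr rfl h1, Finset.prod_one_add]
  apply Finset.sum_congr rfl
  intro R _
  rw [Finset.prod_ite_zero]; simp

lemma F_add {n : ℕ} {P Q R : AT n → Prop} (h : ∀ t, P t ↔ (Q t ∨ R t)) (hd : ∀ t, Q t → ¬ R t)
    (m : ℕ) : (F P m).card = (F Q m).card + (F R m).card := by
  classical
  rw [← Finset.card_union_of_disjoint]
  · congr 1; ext t; simp only [Finset.mem_union, mem_F, h]; tauto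
  · rw [Finset.disjoint_left]; intro t; simp only [mem_F]; intro h1 h2; exact hd t h1.1 h2.1

lemma F_mono {n : ℕ} {P Q : AT n → Prop} (h : ∀ t, P t → Q t) (m : ℕ) :
    (F P m).card ≤ (F Q m).card := by
  apply Finset.card_le_card
  intro t; simp only [mem_F]; exact fun ht => ⟨h t ht.1, ht.2⟩

lemma gf_lP {n : ℕ} (S : Finset (Fin n → Bool)) :
    gf (lP S) = C ((F (lP S) 1).card : ℝ) * X := by
  ext m
  rw [coeff_C_mul, coeff_X, coeff_gf]
  split_ifs with h
  · rw [h]; simp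
  · rw [mul_zero, Nat.cast_eq_zero, Finset.card_eq_zero]
    ext t; rw [mem_F]
    cases t with
    | leaf i b => simp [size]; intro _ _; omega
    | node c ts => simp [lP, rootConn]

lemma gf_gP {n : ℕ} (S : Finset (Fin n → Bool)) :
    gf (gP S) = C ((F (lP S) 1).card : ℝ) * X + gf (bP S) := by
  rw [← gf_lP]
  ext m
  rw [map_add, coeff_gf, coeff_gf, coeff_gf, F_add (Q := lP S) (R := bP S)]
  · push_cast; rfl
  · intro t
    cases t with
    | leaf => simp [gP, lP, bP, rootConn]
    | node c ts => cases c <;> simp [gP, lP, bP, rootConn]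
  · intro t h h'
    rw [lP] at h; rw [bP] at h'
    simp [h.1] at h'

lemma card_lP_empty (n : ℕ) : (F (lP (∅ : Finset (Fin n → Bool))) 1).card = 2 * n := by
  classical
  have : F (lP (∅ : Finset (Fin n → Bool))) 1
      = (Finset.univ : Finset (Fin n × Bool)).image fun p => AT.leaf p.1 p.2 := by
    ext t
    simp only [mem_F, Finset.mem_image, Finset.mem_univ, true_and, Prod.exists]
    cases t with
    | leaf i b => simp [lP, rootConn, size, WF.leaf]
    | node c ts => simp [lP, rootConn]
  rw [this, Finset.card_image_of_injective]
  · simp [mul_comm]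
  · rintro ⟨i, b⟩ ⟨i', b'⟩ h; simpa using h

lemma card_lP_univ (n : ℕ) : (F (lP (Finset.univ : Finset (Fin n → Bool))) 1).card = 0 := by
  rw [Finset.card_eq_zero]
  ext t; rw [mem_F]
  cases t with
  | leaf i b =>
    simp [lP, rootConn]
    intro h
    have := h (fun _ => !b)
    cases b <;> simp [eval] at this
  | node c ts => simp [lP, rootConn]

lemma card_gP_lt {n : ℕ} (hn : 1 ≤ n) (S : Finset (Fin n → Bool)) (hS : S.Nonempty) :
    (F (gP S) 1).card < (F (gP (∅ : Finset (Fin n → Bool))) 1).card := by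
  obtain ⟨σ, hσ⟩ := hS
  apply Finset.card_lt_card
  rw [Finset.ssubset_iff_of_subset]
  · refine ⟨AT.leaf ⟨0, hn⟩ (!σ ⟨0, hn⟩), ?_, ?_⟩
    · rw [mem_F]; simp [gP, rootConn, size, WF.leaf]
    · rw [mem_F]; rintro ⟨⟨-, h⟩, -⟩
      have := h σ hσ
      simp [eval] at this
  · intro t; simp only [mem_F]; rintro ⟨h, h'⟩
    exact ⟨⟨h.1, by simp⟩, h'⟩

lemma card_bP_ge {n : ℕ} (hn : 1 ≤ n) (m : ℕ) :
    (F (aP (∅ : Finset (Fin n → Bool))) m).card ≤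
      (F (bP (Finset.univ : Finset (Fin n → Bool))) (m + 3)).card := by
  apply Finset.card_le_card_of_injOn
    (fun t => AT.node false [AT.leaf ⟨0, hn⟩ true, AT.leaf ⟨0, hn⟩ false, t])
  · intro t ht
    rw [Finset.mem_coe, mem_F] at ht ⊢
    obtain ⟨⟨h1, -⟩, h2, h3⟩ := ht
    refine ⟨⟨rfl, ?_⟩, ?_, ?_⟩
    · intro σ _
      cases h : σ ⟨0, hn⟩ <;> simp [eval, evalList, h]
    · rw [WF_node]
      refine ⟨by simp, ?_, ?_⟩
      · simp [WF.leaf, h2]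
      · intro u hu
        simp only [List.mem_cons, List.not_mem_nil, or_false] at hu
        rcases hu with rfl | rfl | rfl
        · simp [rootConn]
        · simp [rootConn]
        · rw [h1]; simp
    · simp [size, sizeList, h3]; omega
  · intro t _ s _ h
    simpa using h

lemma F_all {n : ℕ} (m : ℕ) (hm : 2 ≤ m) :
    (F (fun _ : AT n => True) m).card = 2 * (F (aP (∅ : Finset (Fin n → Bool))) m).card := by
  rw [two_mul]
  nth_rw 2 [← F_nP]
  rw [← F_add (P := fun t => rootConn t ≠ none)]
  · congr 1
    ext t; simp only [mem_F]
    cases t with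
    | leaf => simp [rootConn, size]; intros; omega
    | node => simp [rootConn]
  · intro t
    cases t with
    | leaf => simp [aP, nP, rootConn]
    | node c ts => cases c <;> simp [aP, nP, rootConn]
  · intro t h h'
    rw [aP] at h; rw [nP] at h'
    simp [h.1] at h'

lemma F_true {n : ℕ} (m : ℕ) (hm : 2 ≤ m) :
    (F (fun t : AT n => eval t = fun _ => true) m).card
      = (F (aP (Finset.univ : Finset (Fin n → Bool))) m).card
        + (F (bP (Finset.univ : Finset (Fin n → Bool))) m).card := by
  rw [← F_add (P := fun t => rootConn t ≠ none ∧ eval t = fun _ => true)]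
  · congr 1
    ext t; simp only [mem_F]
    cases t with
    | leaf => simp [rootConn, size]; intros; omega
    | node => simp [rootConn]
  · intro t
    cases t with
    | leaf => simp [aP, bP, rootConn]
    | node c ts => cases c <;> simp [aP, bP, rootConn, funext_iff]
  · intro t h h'
    rw [aP] at h; rw [bP] at h'
    simp [h.1] at h'

lemma F_simple {n : ℕ} (x : Fin n) (m : ℕ) :
    (F (fun t : AT n => t ∈ SimpleX n x) (m + 2)).card
      = 4 * (F (bP (Finset.univ : Finset (Fin n → Bool))) m).card := by
  classical
  set B := F (bP (Finset.univ : Finset (Fin n → Bool))) m with hB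
  set A' := F (fun t : AT n => rootConn t = some true ∧ ∀ σ, eval t σ = false) m with hA
  have hAB : A'.card = B.card := by
    symm
    apply F_neg
    intro t
    simp only [bP]
    rw [show (some false : Option Bool) = some (!true) from rfl, rootConn_neg_iff]
    simp [eval_neg]
  have e : F (fun t : AT n => t ∈ SimpleX n x) (m + 2)
      = ((A'.image fun s => AT.node false [AT.leaf x true, s]) ∪
         (A'.image fun s => AT.node false [s, AT.leaf x true])) ∪
        ((B.image fun s => AT.node true [AT.leaf x true, s]) ∪
         (B.image fun s => AT.node true [s, AT.leaf x true])) := by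
    ext t
    simp only [Finset.mem_union, Finset.mem_image, hA, hB, mem_F, SimpleX, Set.mem_ofPred_eq, bP]
    constructor
    · rintro ⟨⟨s, hs, ⟨he, rfl | rfl⟩ | ⟨he, rfl | rfl⟩⟩, hw, hsz⟩ <;>
      · rw [WF_node] at hw
        obtain ⟨-, hw1, hw2⟩ := hw
        have h1 := hw1 s (by simp)
        have h2 := hw2 s (by simp)
        have h3 : size s = m := by simp [size, sizeList] at hsz; omega
        cases s with
        | leaf => simp [isLeafB] at hs
        | node c ts => cases c <;> simp_all [rootConn]
    · have aux : ∀ (c : Bool) (s : AT n), rootConn s = some (!c) → WF s →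
          WF (AT.node c [AT.leaf x true, s]) ∧ WF (AT.node c [s, AT.leaf x true]) := by
        intro c s h1 h2
        rw [WF_node, WF_node]
        cases c <;> simp_all [rootConn, WF.leaf]
      rintro ((⟨s, ⟨⟨h1, h2⟩, h3, h4⟩, rfl⟩ | ⟨s, ⟨⟨h1, h2⟩, h3, h4⟩, rfl⟩) |
        (⟨s, ⟨⟨h1, h2⟩, h3, h4⟩, rfl⟩ | ⟨s, ⟨⟨h1, h2⟩, h3, h4⟩, rfl⟩))
      all_goals
        have hlf : isLeafB s = false := by
          cases s with
          | leaf => simp [rootConn] at h1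
          | node => rfl
      · exact ⟨⟨s, hlf, Or.inl ⟨funext h2, Or.inl rfl⟩⟩, (aux false s h1 h3).1,
          by simp [size, sizeList]; omega⟩
      · exact ⟨⟨s, hlf, Or.inl ⟨funext h2, Or.inr rfl⟩⟩, (aux false s h1 h3).2,
          by simp [size, sizeList]; omega⟩
      · exact ⟨⟨s, hlf, Or.inr ⟨funext fun σ => h2 σ (by simp), Or.inl rfl⟩⟩, (aux true s h1 h3).1,
          by simp [size, sizeList]; omega⟩
      · exact ⟨⟨s, hlf, Or.inr ⟨funext fun σ => h2 σ (by simp), Or.inr rfl⟩⟩, (aux true s h1 h3).2,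
          by simp [size, sizeList]; omega⟩
  have i1 : ∀ c : Bool, Function.Injective fun s => AT.node c [AT.leaf x true, s] := by
    intro c s s' h; simpa using h
  have i2 : ∀ c : Bool, Function.Injective fun s => AT.node c [s, AT.leaf x true] := by
    intro c s s' h; simpa using h
  rw [e, Finset.card_union_of_disjoint, Finset.card_union_of_disjoint,
    Finset.card_union_of_disjoint, Finset.card_image_of_injective _ (i1 _),
    Finset.card_image_of_injective _ (i2 _), Finset.card_image_of_injective _ (i1 _),
    Finset.card_image_of_injective _ (i2 _), hAB]
  · ring
  · rw [Finset.disjoint_left]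
    intro t h h'
    simp only [Finset.mem_image] at h h'
    obtain ⟨s, hs, rfl⟩ := h
    obtain ⟨s', hs', h⟩ := h'
    simp at h
    rw [hB, mem_F, bP, ← h.2] at hs
    simp [rootConn] at hs
  · rw [Finset.disjoint_left]
    intro t h h'
    simp only [Finset.mem_image] at h h'
    obtain ⟨s, hs, rfl⟩ := h
    obtain ⟨s', hs', h⟩ := h'
    simp at h
    rw [hA, mem_F, ← h.2] at hs
    simp [rootConn] at hs
  · rw [Finset.disjoint_left]
    intro t h h'
    simp only [Finset.mem_union, Finset.mem_image] at h h'
    rcases h with ⟨s, hs, rfl⟩ | ⟨s, hs, rfl⟩ <;>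
    rcases h' with ⟨s', hs', h⟩ | ⟨s', hs', h⟩ <;> simp at h

end Stmt16

namespace Stmt16
open AT PowerSeries Filter Topology

noncomputable def rs {n : ℕ} (ρ : ℝ) (P : AT n → Prop) : ℝ⟦X⟧ := rescale ρ (gf P)

lemma coeff_rs {n : ℕ} (ρ : ℝ) (P : AT n → Prop) (m : ℕ) :
    coeff m (rs ρ P) = ρ ^ m * ((F P m).card : ℝ) := by
  rw [rs, coeff_rescale, coeff_gf]

lemma rescale_C' (ρ c : ℝ) : rescale ρ (C c) = C c := by
  ext m; rw [coeff_rescale, coeff_C]; split_ifs with hm <;> simp [hm]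

lemma rs_aP {n : ℕ} (ρ : ℝ) (S : Finset (Fin n → Bool)) :
    rs ρ (aP S) = rs ρ (gP S) * rs ρ (aP S) + C ρ * (X * (rs ρ (gP S) * rs ρ (gP S))) := by
  have h := congrArg (rescale ρ) (gf_aP S)
  simp only [map_add, map_mul, rescale_X] at h
  rw [mul_assoc] at h
  exact h

lemma rs_bP {n : ℕ} (ρ : ℝ) (S : Finset (Fin n → Bool)) :
    rs ρ (bP S) = ∑ R ∈ S.powerset, C ((-1 : ℝ) ^ R.card) * rs ρ (aP R) := by
  have h := congrArg (rescale ρ) (gf_bP S)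
  simp only [map_sum, map_mul, rescale_C'] at h
  exact h

lemma rs_gP {n : ℕ} (ρ : ℝ) (S : Finset (Fin n → Bool)) :
    rs ρ (gP S) = C (((F (lP S) 1).card : ℝ) * ρ) * X + rs ρ (bP S) := by
  have h := congrArg (rescale ρ) (gf_gP S)
  simp only [map_add, map_mul, rescale_C', rescale_X] at h
  rw [rs, rs, h, map_mul]; ring

lemma rs_nonneg {n : ℕ} {ρ : ℝ} (hρ : 0 ≤ ρ) (P : AT n → Prop) (m : ℕ) :
    0 ≤ coeff m (rs ρ P) := by
  rw [coeff_rs]; positivity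

lemma rs_mono {n : ℕ} {ρ : ℝ} (hρ : 0 ≤ ρ) {P Q : AT n → Prop} (h : ∀ t, P t → Q t) (m : ℕ) :
    coeff m (rs ρ P) ≤ coeff m (rs ρ Q) := by
  rw [coeff_rs, coeff_rs]
  have := F_mono h m
  gcongr

lemma Asy.unique {x : ℝ⟦X⟧} {l l' : ℝ} (h : Asy x l 0) (h' : Asy x l' 0) : l = l' :=
  tendsto_nhds_unique h.tendsto h'.tendsto

lemma summable_le {x y : ℝ⟦X⟧} (h0 : ∀ m, 0 ≤ coeff m x) (h : ∀ m, coeff m x ≤ coeff m y)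
    (hy : Summable fun m => |coeff m y|) : Summable fun m => |coeff m x| := by
  refine Summable.of_nonneg_of_le (fun _ => abs_nonneg _) (fun m => ?_) hy
  rw [abs_of_nonneg (h0 m)]
  exact (h m).trans (le_abs_self _)

lemma hat_eq {a g : ℝ⟦X⟧} {ρ : ℝ} (heq : a = g * a + C ρ * (X * (g * g)))
    (ha : ∃ c, ∀ m, |coeff m a| ≤ c * nu m) (hg : ∃ c, ∀ m, |coeff m g| ≤ c * nu m) :
    hat a = hat g * hat a + ρ * (hat g * hat g) := by
  obtain ⟨ca, ha⟩ := ha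
  obtain ⟨cg, hg⟩ := hg
  have aa := asy_of_bound ha
  have ag := asy_of_bound hg
  have h : hat a = hat (g * a + C ρ * (X * (g * g))) := by rw [← heq]
  refine h.trans ?_
  rw [hat_add (ag.mul aa).summable ((ag.mul ag).X_mul.smul ρ).summable, hat_C_mul,
      hat_mul asy_X.summable (ag.mul ag).summable, hat_mul ag.summable ag.summable,
      hat_mul ag.summable aa.summable, hat_X, one_mul]

set_option maxHeartbeats 1000000 in
theorem perN (n : ℕ) (hn : 1 ≤ n) (s ρ c : ℝ) (hs : s = √(2 * n))
    (hρ : ρ = 1 / (s * (s + 2))) (hc : c = s / (s + 2)) :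
    ∃ μ p : ℝ, HasLimRatio n (SimpleX n ⟨0, hn⟩) μ ∧
      Tendsto (fun m => Pmn n m (fun _ => true)) atTop (𝓝 p) ∧
      c ^ 2 / (1 + 2 * ρ) ≤ (n : ℝ) ^ 2 * μ / p ∧ (n : ℝ) ^ 2 * μ / p ≤ c ^ 2 := by
  have hn' : (1 : ℝ) ≤ n := by exact_mod_cast hn
  have hs2 : s ^ 2 = 2 * n := by rw [hs, Real.sq_sqrt (by positivity)]
  have hs0 : 0 ≤ s := by rw [hs]; positivity
  have hs1 : 1 < s := by nlinarith
  have hρ0 : 0 < ρ := by rw [hρ]; positivity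
  have hcn : c = 2 * n * ρ := by
    rw [hc, hρ, ← hs2]; field_simp
  have hlP : (((F (lP (∅ : Finset (Fin n → Bool))) 1).card : ℝ) * ρ) = c := by
    rw [card_lP_empty, hcn]; push_cast; ring
  have hB0 : rs ρ (bP (∅ : Finset (Fin n → Bool))) = rs ρ (aP (∅ : Finset (Fin n → Bool))) := by
    rw [rs_bP]; simp
  have hG0 := rs_gP ρ (∅ : Finset (Fin n → Bool))
  rw [hlP, hB0] at hG0
  obtain ⟨⟨L, hL, hN⟩, hT⟩ := base hs1 hρ hc (T := rs ρ (gP (∅ : Finset (Fin n → Bool))))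
    (N := rs ρ (aP (∅ : Finset (Fin n → Bool)))) (rs_nonneg hρ0.le _)
    (by rw [coeff_rs, F_zero]; simp) hG0 (rs_aP ρ ∅)
  have hTasy : Asy (rs ρ (gP (∅ : Finset (Fin n → Bool)))) L 0 := by
    have := (asy_X.smul c).add hN
    rw [← hG0] at this
    simpa using this
  -- comparison facts
  have aLe : ∀ S : Finset (Fin n → Bool), ∀ m,
      coeff m (rs ρ (aP S)) ≤ coeff m (rs ρ (aP (∅ : Finset (Fin n → Bool)))) := fun S m =>
    rs_mono hρ0.le (fun t h => ⟨h.1, by simp⟩) m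
  have bLe : ∀ S : Finset (Fin n → Bool), ∀ m,
      coeff m (rs ρ (bP S)) ≤ coeff m (rs ρ (aP (∅ : Finset (Fin n → Bool)))) := fun S m => by
    rw [← hB0]
    exact rs_mono hρ0.le (fun t h => ⟨h.1, by simp⟩) m
  have gLe : ∀ S : Finset (Fin n → Bool), ∀ m,
      coeff m (rs ρ (gP S)) ≤ coeff m (rs ρ (gP (∅ : Finset (Fin n → Bool)))) := fun S m =>
    rs_mono hρ0.le (fun t h => ⟨h.1, by simp⟩) m
  obtain ⟨ca, -, hca⟩ := hN.bound
  obtain ⟨cg, -, hcg⟩ := hTasy.bound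
  have aB : ∀ S : Finset (Fin n → Bool), ∀ m, |coeff m (rs ρ (aP S))| ≤ ca * nu m := fun S m => by
    rw [abs_of_nonneg (rs_nonneg hρ0.le _ m)]
    exact (aLe S m).trans ((le_abs_self _).trans (hca m))
  have gB : ∀ S : Finset (Fin n → Bool), ∀ m, |coeff m (rs ρ (gP S))| ≤ cg * nu m := fun S m => by
    rw [abs_of_nonneg (rs_nonneg hρ0.le _ m)]
    exact (gLe S m).trans ((le_abs_self _).trans (hcg m))
  have hatEq : ∀ S : Finset (Fin n → Bool), hat (rs ρ (aP S)) = hat (rs ρ (gP S)) *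
      hat (rs ρ (aP S)) + ρ * (hat (rs ρ (gP S)) * hat (rs ρ (gP S))) := fun S =>
    hat_eq (rs_aP ρ S) ⟨ca, aB S⟩ ⟨cg, gB S⟩
  -- convergence for every S
  have main : ∀ S : Finset (Fin n → Bool), ∃ l, Asy (rs ρ (aP S)) l 0 := by
    classical
    intro S
    induction S using Finset.strongInduction with
    | H S ih =>
      by_cases hS : S = ∅
      · subst hS; exact ⟨L, hN⟩
      have hSn : S.Nonempty := Finset.nonempty_iff_ne_empty.mpr hS
      choose l hl using ih
      set k : ℝ⟦X⟧ := C (((F (lP S) 1).card : ℝ) * ρ) * X +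
        ∑ R ∈ S.ssubsets.attach, C ((-1 : ℝ) ^ R.1.card) * rs ρ (aP R.1) with hk
      have hgk : rs ρ (gP S) = k + C ((-1 : ℝ) ^ S.card) * rs ρ (aP S) := by
        rw [rs_gP, rs_bP, hk, Finset.sum_attach S.ssubsets
          (fun R => C ((-1 : ℝ) ^ R.card) * rs ρ (aP R)), Finset.ssubsets, add_assoc,
          Finset.sum_erase_add]
        exact Finset.mem_powerset_self S
      have hka : Asy k (((F (lP S) 1).card : ℝ) * ρ * 0 + ∑ R ∈ S.ssubsets.attach,
          (-1 : ℝ) ^ R.1.card * l R.1 (Finset.mem_ssubsets.mp R.2)) 0 := by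
        have h1 := asy_X.smul (((F (lP S) 1).card : ℝ) * ρ)
        have h2 := Asy.sum S.ssubsets.attach
          (fun R => C ((-1 : ℝ) ^ R.1.card) * rs ρ (aP R.1))
          (fun R => (-1 : ℝ) ^ R.1.card * l R.1 (Finset.mem_ssubsets.mp R.2))
          (fun R => |(-1 : ℝ) ^ R.1.card| * 0)
          (fun R _ => (hl R.1 (Finset.mem_ssubsets.mp R.2)).smul _)
        exact (h1.add h2).mono (by simp)
      have hlt : hat (rs ρ (gP S)) < s / (s + 1) := by
        rw [← hT]
        refine Summable.tsum_lt_tsum (i := 1) (gLe S) ?_ (summable_of_bound (gB S)).of_abs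
          (summable_of_bound (gB ∅)).of_abs
        rw [coeff_rs, coeff_rs]
        have : ((F (gP S) 1).card : ℝ) < (F (gP (∅ : Finset (Fin n → Bool))) 1).card := by
          exact_mod_cast card_gP_lt hn S hSn
        gcongr
      have hgn : 0 ≤ hat (rs ρ (gP S)) := tsum_nonneg (rs_nonneg hρ0.le _)
      have hE := hatEq S
      obtain ⟨w, hw, -⟩ := contraction (σ := (-1 : ℝ) ^ S.card) hρ0.le (by simp)
        (rs_nonneg hρ0.le (aP S)) (rs_nonneg hρ0.le (gP S))
        ⟨ca, fun m => (le_abs_self _).trans (aB S m)⟩ hgk hka (rs_aP ρ S) (by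
          generalize hat (rs ρ (gP S)) = h at *
          generalize hat (rs ρ (aP S)) = a at *
          have h1 : 1 / (s + 1) < 1 - h := by
            have : s / (s + 1) = 1 - 1 / (s + 1) := by field_simp; ring
            linarith
          have h2 : 0 < 1 - h := lt_trans (by positivity) h1
          have h3 : (1 / (s + 1)) ^ 2 < (1 - h) ^ 2 := by gcongr
          have h4 : ρ = (1 + ρ) * (1 / (s + 1)) ^ 2 := by
            rw [hρ]; field_simp; ring
          have h5 : ρ < (1 + ρ) * (1 - h) ^ 2 := by
            calc ρ = (1 + ρ) * (1 / (s + 1)) ^ 2 := h4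
              _ < _ := by gcongr
          have h6 : (a + 2 * ρ * h) * (1 - h) < (1 - h) * (1 - h) := by nlinarith
          exact lt_of_mul_lt_mul_right h6 h2.le)
      exact ⟨w, hw⟩
  -- the case S = univ
  obtain ⟨w, hw⟩ := main Finset.univ
  choose la hla using main
  have hGB : rs ρ (gP (Finset.univ : Finset (Fin n → Bool))) = rs ρ (bP (Finset.univ : Finset (Fin n → Bool))) := by
    rw [rs_gP, card_lP_univ]; simp
  obtain ⟨v, hv⟩ : ∃ v, Asy (rs ρ (bP (Finset.univ : Finset (Fin n → Bool)))) v 0 := by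
    have h2 := Asy.sum (Finset.univ : Finset (Fin n → Bool)).powerset
      (fun R => C ((-1 : ℝ) ^ R.card) * rs ρ (aP R))
      (fun R => (-1 : ℝ) ^ R.card * la R)
      (fun R => |(-1 : ℝ) ^ R.card| * 0)
      (fun R _ => (hla R).smul _)
    refine ⟨∑ R ∈ (Finset.univ : Finset (Fin n → Bool)).powerset, (-1 : ℝ) ^ R.card * la R, ?_⟩
    rw [rs_bP]
    exact h2.mono (by simp)
  have hv0 : 0 < v := by
    have h1 : Asy (C (ρ ^ 3) * (X ^ 3 * rs ρ (aP (∅ : Finset (Fin n → Bool))))) (ρ ^ 3 * L) 0 := by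
      exact ((hN.X_pow_mul 3).smul (ρ ^ 3)).mono (by rw [mul_zero])
    have h2 : ρ ^ 3 * L ≤ v := by
      refine le_of_tendsto_of_tendsto h1.tendsto hv.tendsto ?_
      rw [EventuallyLE, ← map_add_atTop_eq_nat 3, eventually_map]
      filter_upwards with m
      have := nu_pos (m + 3)
      gcongr
      rw [coeff_C_mul, coeff_X_pow_mul, coeff_rs, coeff_rs, pow_add]
      have h3 : ((F (aP (∅ : Finset (Fin n → Bool))) m).card : ℝ) ≤
        (F (bP (Finset.univ : Finset (Fin n → Bool))) (m + 3)).card := by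
        exact_mod_cast card_bP_ge hn m
      have h4 : 0 ≤ ρ ^ m * ρ ^ 3 := by positivity
      calc ρ ^ 3 * (ρ ^ m * ((F (aP (∅ : Finset (Fin n → Bool))) m).card : ℝ))
          = ρ ^ m * ρ ^ 3 * ((F (aP (∅ : Finset (Fin n → Bool))) m).card : ℝ) := by ring
        _ ≤ _ := mul_le_mul_of_nonneg_left h3 h4
    exact lt_of_lt_of_le (mul_pos (pow_pos hρ0 3) hL) h2
  have hE := hatEq Finset.univ
  have hrel : w = hat (rs ρ (gP (Finset.univ : Finset (Fin n → Bool)))) * w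
      + hat (rs ρ (aP (Finset.univ : Finset (Fin n → Bool)))) * v
      + 2 * ρ * hat (rs ρ (gP (Finset.univ : Finset (Fin n → Bool)))) * v := by
    have hv' := hv
    rw [← hGB] at hv'
    have h1 := (hv'.mul0 hw).add (((hv'.mul0 hv').X_mul).smul ρ)
    rw [← rs_aP] at h1
    have := hw.unique (h1.mono (by simp))
    linarith
  have hh0 : 0 ≤ hat (rs ρ (gP (Finset.univ : Finset (Fin n → Bool)))) :=
    tsum_nonneg (rs_nonneg hρ0.le _)
  have ha0 : 0 ≤ hat (rs ρ (aP (Finset.univ : Finset (Fin n → Bool)))) :=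
    tsum_nonneg (rs_nonneg hρ0.le _)
  have hh1 : hat (rs ρ (gP (Finset.univ : Finset (Fin n → Bool)))) ≤ 1 / 3 := by
    have hle : hat (rs ρ (gP (Finset.univ : Finset (Fin n → Bool))))
        ≤ hat (rs ρ (aP (∅ : Finset (Fin n → Bool)))) := by
      rw [hGB]
      exact Summable.tsum_le_tsum (bLe Finset.univ) hv.summable.of_abs hN.summable.of_abs
    have hNh : hat (rs ρ (aP (∅ : Finset (Fin n → Bool)))) = s / (s + 1) - c := by
      have : hat (rs ρ (gP (∅ : Finset (Fin n → Bool)))) =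
        hat (C c * X + rs ρ (aP (∅ : Finset (Fin n → Bool)))) := by rw [← hG0]
      rw [hat_add (asy_X.smul c).summable hN.summable, hat_C_mul, hat_X, hT] at this
      linarith
    rw [hNh, hc] at hle
    refine hle.trans ?_
    have : s / (s + 1) - s / (s + 2) = s / ((s + 1) * (s + 2)) := by field_simp; ring
    rw [this, div_le_iff₀ (by positivity)]
    nlinarith
  have hw0 : 0 ≤ w := ge_of_tendsto' hw.tendsto fun m =>
    div_nonneg (rs_nonneg hρ0.le _ m) (nu_pos m).le
  have hwv : w ≤ 2 * ρ * v := by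
    generalize hat (rs ρ (gP (Finset.univ : Finset (Fin n → Bool)))) = h at *
    generalize hat (rs ρ (aP (Finset.univ : Finset (Fin n → Bool)))) = a at *
    have h1 : a ≤ ρ / 6 := by
      have hhh : h * h ≤ 1 / 9 := by nlinarith
      nlinarith [mul_le_mul_of_nonneg_left hhh hρ0.le, mul_le_mul_of_nonneg_right hh1 ha0]
    have h2 : a + 2 * ρ * h ≤ 5 / 6 * ρ := by nlinarith
    have h3 := mul_le_mul_of_nonneg_right h2 hv0.le
    have h4 := mul_le_mul_of_nonneg_right hh1 hw0
    have h5 := mul_pos hρ0 hv0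
    nlinarith
  -- limits
  have hAll : ∀ m, 2 ≤ m → (A n m : ℝ) * ρ ^ m
      = 2 * coeff m (rs ρ (aP (∅ : Finset (Fin n → Bool)))) := by
    intro m hm
    have h1 : A n m = (F (fun _ : AT n => True) m).card := by
      rw [← countIn_eq]; rfl
    rw [h1, F_all m hm, coeff_rs]; push_cast; ring
  have limit : ∀ (x : ℝ⟦X⟧) (l : ℝ) (u : ℕ → ℕ), Asy x l 0 →
      (∀ᶠ m in atTop, (u m : ℝ) * ρ ^ m = coeff m x) →
      Tendsto (fun m => (u m : ℝ) / (A n m : ℝ)) atTop (𝓝 (l / (2 * L))) := by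
    intro x l u hx hu
    have h1 := hx.tendsto.div (hN.tendsto.const_mul 2) (by positivity)
    refine h1.congr' ?_
    filter_upwards [hu, eventually_ge_atTop 2] with m h2 h3
    have hp := (nu_pos m).ne'
    have hr : ρ ^ m ≠ 0 := by positivity
    rw [Pi.div_apply, ← mul_div_assoc, ← hAll m h3, ← h2, div_div_div_cancel_right₀ hp,
      mul_div_mul_right _ _ hr]
  refine ⟨4 * ρ ^ 2 * v / (2 * L), (w + v) / (2 * L), ?_, ?_, ?_⟩
  · refine limit (C (4 * ρ ^ 2) * (X ^ 2 * rs ρ (bP (Finset.univ : Finset (Fin n → Bool))))) _ _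
      (((hv.X_pow_mul 2).smul (4 * ρ ^ 2)).mono (by rw [mul_zero])) ?_
    rw [← map_add_atTop_eq_nat 2, eventually_map]
    filter_upwards with m
    have h1 : countIn n (SimpleX n ⟨0, hn⟩) (m + 2)
        = (F (fun t : AT n => t ∈ SimpleX n ⟨0, hn⟩) (m + 2)).card := by
      rw [← countIn_eq]; rfl
    rw [h1, F_simple, coeff_C_mul, coeff_X_pow_mul, coeff_rs]
    push_cast; ring
  · refine limit (rs ρ (aP (Finset.univ : Finset (Fin n → Bool))) + rs ρ (bP (Finset.univ : Finset (Fin n → Bool)))) _ _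
      ((hw.add hv).mono (by rw [add_zero])) ?_
    filter_upwards [eventually_ge_atTop 2] with m hm
    rw [countIn_eq, F_true m hm, map_add, coeff_rs, coeff_rs]
    push_cast; ring
  · have hval : (n : ℝ) ^ 2 * (4 * ρ ^ 2 * v / (2 * L)) / ((w + v) / (2 * L))
        = c ^ 2 * (v / (w + v)) := by
      rw [hcn]; field_simp; ring
    rw [hval, div_eq_mul_one_div]
    have hwv0 : 0 < w + v := by linarith
    constructor
    · gcongr c ^ 2 * ?_
      rw [div_le_div_iff₀ (by positivity) hwv0]
      linarith
    · have : v / (w + v) ≤ 1 := by rw [div_le_one hwv0]; linarith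
      nlinarith [sq_nonneg c]

end Stmt16

open Filter in
/-- For the literal `x = x₁`, the limiting ratio `μ_n(𝒳)` of the family of simple
`x` trees exists for every `n ≥ 1` and `μ_n(𝒳) ∼ P_n(True)/n²` as `n → ∞`, i.e.
`n²·μ_n(𝒳)/P_n(True) → 1`. -/
theorem statement16 :
    ∃ μ p : ℕ → ℝ,
      (∀ n : ℕ, ∀ h : 1 ≤ n,
        HasLimRatio n (SimpleX n ⟨0, h⟩) (μ n) ∧
        Tendsto (fun m => Pmn n m (fun _ => true)) atTop (nhds (p n))) ∧
      Tendsto (fun n : ℕ => (n : ℝ) ^ 2 * μ n / p n) atTop (nhds 1) := by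
  have key := fun (n : ℕ) (hn : 1 ≤ n) => Stmt16.perN n hn (√(2 * n)) _ _ rfl rfl rfl
  choose μ p h1 h2 h3 h4 using key
  refine ⟨fun n => if h : 1 ≤ n then μ n h else 0, fun n => if h : 1 ≤ n then p n h else 0,
    ?_, ?_⟩
  · intro n h
    simp only [h, dif_pos]
    exact ⟨h1 n h, h2 n h⟩
  · have hs : Tendsto (fun n : ℕ => √(2 * (n : ℝ))) atTop atTop :=
      Real.tendsto_sqrt_atTop.comp
        (tendsto_natCast_atTop_atTop.const_mul_atTop (by norm_num : (0 : ℝ) < 2))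
    have hinv : Tendsto (fun n : ℕ => (√(2 * (n : ℝ)) + 2)⁻¹) atTop (nhds 0) :=
      (tendsto_atTop_add_const_right _ 2 hs).inv_tendsto_atTop
    have hc : Tendsto (fun n : ℕ => √(2 * (n : ℝ)) / (√(2 * (n : ℝ)) + 2)) atTop (nhds 1) := by
      have := (hinv.const_mul 2).const_sub 1
      simp only [mul_zero, sub_zero] at this
      refine this.congr fun n => ?_
      have : √(2 * (n : ℝ)) + 2 ≠ 0 := by positivity
      field_simp; ring
    have hρ : Tendsto (fun n : ℕ => 1 / (√(2 * (n : ℝ)) * (√(2 * (n : ℝ)) + 2))) atTop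
        (nhds 0) := by
      have := hs.inv_tendsto_atTop.mul hinv
      simp only [mul_zero] at this
      refine this.congr fun n => ?_
      simp [mul_comm]
    have hc2 := hc.pow 2
    have hlow := hc2.div ((hρ.const_mul 2).const_add 1) (by norm_num)
    simp only [one_pow, mul_zero, add_zero, div_one] at hlow hc2
    refine tendsto_of_tendsto_of_tendsto_of_le_of_le' hlow hc2 ?_ ?_
    · filter_upwards [eventually_ge_atTop 1] with n hn
      simp only [hn, dif_pos]
      exact h3 n hn
    · filter_upwards [eventually_ge_atTop 1] with n hn
      simp only [hn, dif_pos]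
      exact h4 n hn
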